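/- Let F and F̃ be Borel probability measures on ℝ such that ∫ g dF̃ ≤ ∫ g dF for every integrable non-increasing concave g, with strict inequality for every integrable strictly decreasing strictly concave g (the strict skewness order F̃ ≽_sk F). Let ρ : ℝ × ℝ → ℝ be such that (i) for each G ∈ {F, F̃} the function V_G(x) = ∫ ρ(x,π) dG(π) is differentiable and strictly concave on (0,∞) with V_G'(x) = ∫ ∂ρ/∂x(x,π) dG(π); (ii) for each x > 0 the map π ↦ ∂ρ/∂x(x,π) is strictly increasing, strictly convex, and integrable under both measures; and (iii) each V_G attains an interior maximum at a unique R_L*(G) ∈ (0,∞) characterized by V_G'(R_L*(G)) = 0. Then R_L*(F̃) > R_L*(F). -/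

import Mathlib

open MeasureTheory

/-- Proposition 3 (Skewness-Induced Credit Tightening). If `F̃ ≽_sk F` in the strict
skewness order (`∫ g dF̃ ≤ ∫ g dF` for all integrable non-increasing concave `g`,
strictly for strictly decreasing strictly concave `g`), the objectives
`V_G(x) = ∫ ρ(x,π) dG(π)` are differentiable and strictly concave on `(0,∞)` with
derivative `∫ ρ'(x,π) dG(π)`, the marginal payoff `π ↦ ρ'(x,π)` is strictly
increasing, strictly convex, and integrable under both measures, and each `V_G` has
a unique interior maximizer `R_L*(G)` characterized by the first-order condition,
then `R_L*(F̃) > R_L*(F)`. -/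
theorem skew_raises_loan_rate
    (F Ft : Measure ℝ) [IsProbabilityMeasure F] [IsProbabilityMeasure Ft]
    (hsk : ∀ g : ℝ → ℝ, Antitone g → ConcaveOn ℝ Set.univ g →
      Integrable g F → Integrable g Ft → ∫ π, g π ∂Ft ≤ ∫ π, g π ∂F)
    (hsk_strict : ∀ g : ℝ → ℝ, StrictAnti g → StrictConcaveOn ℝ Set.univ g →
      Integrable g F → Integrable g Ft → ∫ π, g π ∂Ft < ∫ π, g π ∂F)
    (ρ ρ' : ℝ → ℝ → ℝ)
    -- (i) differentiability and strict concavity of the objectives on (0,∞)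
    (hderivF : ∀ x ∈ Set.Ioi (0:ℝ),
      HasDerivAt (fun y => ∫ π, ρ y π ∂F) (∫ π, ρ' x π ∂F) x)
    (hderivFt : ∀ x ∈ Set.Ioi (0:ℝ),
      HasDerivAt (fun y => ∫ π, ρ y π ∂Ft) (∫ π, ρ' x π ∂Ft) x)
    (hconcF : StrictConcaveOn ℝ (Set.Ioi (0:ℝ)) (fun y => ∫ π, ρ y π ∂F))
    (hconcFt : StrictConcaveOn ℝ (Set.Ioi (0:ℝ)) (fun y => ∫ π, ρ y π ∂Ft))
    -- (ii) the marginal payoff is strictly increasing and strictly convex in π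
    (hmono : ∀ x ∈ Set.Ioi (0:ℝ), StrictMono (fun π => ρ' x π))
    (hconv : ∀ x ∈ Set.Ioi (0:ℝ), StrictConvexOn ℝ Set.univ (fun π => ρ' x π))
    (hintF : ∀ x ∈ Set.Ioi (0:ℝ), Integrable (fun π => ρ' x π) F)
    (hintFt : ∀ x ∈ Set.Ioi (0:ℝ), Integrable (fun π => ρ' x π) Ft)
    -- (iii) unique interior maximizers characterized by the first-order condition
    (RF RFt : ℝ) (hRF : RF ∈ Set.Ioi (0:ℝ)) (hRFt : RFt ∈ Set.Ioi (0:ℝ))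
    (hmaxF : IsMaxOn (fun y => ∫ π, ρ y π ∂F) (Set.Ioi (0:ℝ)) RF)
    (hmaxFt : IsMaxOn (fun y => ∫ π, ρ y π ∂Ft) (Set.Ioi (0:ℝ)) RFt)
    (hfocF : ∫ π, ρ' RF π ∂F = 0)
    (hfocFt : ∫ π, ρ' RFt π ∂Ft = 0)
    (huniqF : ∀ x ∈ Set.Ioi (0:ℝ), (∫ π, ρ' x π ∂F) = 0 → x = RF)
    (huniqFt : ∀ x ∈ Set.Ioi (0:ℝ), (∫ π, ρ' x π ∂Ft) = 0 → x = RFt) :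
    RF < RFt := by
  have hpos : 0 < ∫ π, ρ' RF π ∂Ft := by
    have h := hsk_strict (fun π => -ρ' RF π) (hmono RF hRF).neg (hconv RF hRF).neg
      (hintF RF hRF).neg (hintFt RF hRF).neg
    rw [integral_neg, integral_neg, hfocF] at h
    linarith
  by_contra! hle
  rcases hle.eq_or_lt with heq | hlt
  · rw [heq] at hfocFt
    exact hpos.ne' hfocFt
  · have hslope := hconcFt.concaveOn.le_slope_of_hasDerivAt hRFt hRF hlt (hderivFt RF hRF)
    have hval : ∫ π, ρ RF π ∂Ft ≤ ∫ π, ρ RFt π ∂Ft := hmaxFt hRF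
    rw [slope_def_field] at hslope
    exact (hpos.trans_le hslope).not_ge
      (div_nonpos_of_nonpos_of_nonneg (sub_nonpos.mpr hval) (sub_nonneg.mpr hlt.le))
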